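/- arXiv:1806.02524 — 2 statements merged into one kernel-verified Lean document; each statement's English description precedes it below -/
import Mathlib

section
/- For every locally small category 𝒦, the free colimit completion 𝒫𝒦 is complete if and only if 𝒦 is pre-complete, and 𝒫𝒦 is finitely complete if and only if 𝒦 is finitely pre-complete. -/
/- Common definitions for formalizing "How nice are free completions of categories?"
   by Adámek and Rosický. -/

open CategoryTheory CategoryTheory.Limits

universe w w₁ w₂ v₁ u₁

namespace FreeCompletions

/-- A presheaf is *small* if it is a colimit of representables over a small
(`Type w`-indexed) diagram. -/
def IsSmallPresheaf {C : Type u₁} [Category.{v₁} C] (F : Cᵒᵖ ⥤ Type v₁) : Prop :=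
  ∃ (J : Type w) (_ : SmallCategory J) (D : J ⥤ C) (c : Cocone (D ⋙ yoneda)),
    Nonempty (IsColimit c) ∧ Nonempty (c.pt ≅ F)

/-- A presheaf is a (small) coproduct of representables. -/
def IsCoproductOfRepresentables {C : Type u₁} [Category.{v₁} C] (F : Cᵒᵖ ⥤ Type v₁) : Prop :=
  ∃ (I : Type v₁) (A : I → C), Nonempty (F ≅ ∐ fun i => yoneda.obj (A i))

/-- The free coproduct completion `Σ𝒦`, realized as the full subcategory of presheaves
consisting of coproducts of representables. -/
abbrev SigmaCompletion (K : Type u₁) [Category.{v₁} K] :=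
  ObjectProperty.FullSubcategory (IsCoproductOfRepresentables (C := K))

/-- The free colimit completion `𝒫𝒦`, the full subcategory of presheaves
consisting of the small presheaves. -/
abbrev PCompletion (K : Type u₁) [Category.{v₁} K] :=
  ObjectProperty.FullSubcategory (IsSmallPresheaf.{v₁} (C := K))

/-- The object of `Σ𝒦` given by a small family of objects of `𝒦`. -/
noncomputable def famObj {K : Type u₁} [Category.{v₁} K] {I : Type v₁} (B : I → K) :
    SigmaCompletion K :=
  ⟨∐ fun i => yoneda.obj (B i), ⟨I, B, ⟨Iso.refl _⟩⟩⟩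

theorem isSmallPresheaf_coprod {K : Type u₁} [Category.{v₁} K] {I : Type v₁} (B : I → K) :
    IsSmallPresheaf.{v₁} (∐ fun i => yoneda.obj (B i)) := by
  let G := Discrete.functor (fun i => yoneda.obj (B i))
  let e : Discrete.functor B ⋙ yoneda ≅ G := Discrete.natIso (fun i => Iso.refl _)
  exact ⟨Discrete I, inferInstance, Discrete.functor B,
    (Cocone.precompose e.hom).obj (colimit.cocone G),
    ⟨(IsColimit.precomposeHomEquiv e (colimit.cocone G)).symm (colimit.isColimit G)⟩,
    ⟨Iso.refl _⟩⟩

/-- The object of `𝒫𝒦` given by a small coproduct of representables. -/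
noncomputable def pcoprodObj {K : Type u₁} [Category.{v₁} K] {I : Type v₁} (B : I → K) :
    PCompletion K :=
  ⟨∐ fun i => yoneda.obj (B i), isSmallPresheaf_coprod B⟩

/-- A diagram `D` has a *multi-limit*: a set of cones through which every cone
factorizes uniquely (unique member and unique factorization). -/
def HasMultiLimit {J : Type w₁} [Category.{w₂} J] {C : Type u₁} [Category.{v₁} C]
    (D : J ⥤ C) : Prop :=
  ∃ (T : Type w) (c : T → Cone D), ∀ s : Cone D,
    ∃ p : Σ t : T, s ⟶ c t, ∀ q : Σ t : T, s ⟶ c t, q = p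

/-- `𝒦` is finitely multi-complete: every finite diagram has a multi-limit. -/
def FinitelyMultiComplete (C : Type u₁) [Category.{v₁} C] : Prop :=
  ∀ (J : Type) [SmallCategory J] [FinCategory J] (D : J ⥤ C), HasMultiLimit.{v₁} D

/-- A family `A : I → C` has a *multi-product*: a set of cones through which every cone
factorizes uniquely (unique member and unique factorization). -/
def HasMultiProduct {C : Type u₁} [Category.{v₁} C] {I : Type w₁} (A : I → C) : Prop :=
  ∃ (T : Type w) (P : T → C) (π : ∀ t i, P t ⟶ A i),
    ∀ (X : C) (f : ∀ i, X ⟶ A i),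
      ∃ p : Σ t : T, X ⟶ P t, (∀ i, p.2 ≫ π p.1 i = f i) ∧
        ∀ q : Σ t : T, X ⟶ P t, (∀ i, q.2 ≫ π q.1 i = f i) → q = p

/-- `C` has multi-products of all set-indexed families. -/
def HasMultiProducts (C : Type u₁) [Category.{v₁} C] : Prop :=
  ∀ (I : Type v₁) (A : I → C), HasMultiProduct.{v₁} A

/-- A diagram `D` has a *pre-limit*: a set of cones through which every cone
factorizes (not necessarily uniquely). -/
def HasPreLimit {J : Type w₁} [Category.{w₂} J] {C : Type u₁} [Category.{v₁} C]
    (D : J ⥤ C) : Prop :=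
  ∃ (T : Type w) (c : T → Cone D), ∀ s : Cone D, ∃ t : T, Nonempty (s ⟶ c t)

/-- `C` is pre-complete: every small diagram has a pre-limit. -/
def PreComplete (C : Type u₁) [Category.{v₁} C] : Prop :=
  ∀ (J : Type v₁) [SmallCategory J] (D : J ⥤ C), HasPreLimit.{v₁} D

/-- `C` is finitely pre-complete: every finite diagram has a pre-limit. -/
def FinitelyPreComplete (C : Type u₁) [Category.{v₁} C] : Prop :=
  ∀ (J : Type) [SmallCategory J] [FinCategory J] (D : J ⥤ C), HasPreLimit.{v₁} D

/-- A family `A : I → C` has a *pre-product*: a set of cones through which every cone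
factorizes (not necessarily uniquely). -/
def HasPreProduct {C : Type u₁} [Category.{v₁} C] {I : Type w₁} (A : I → C) : Prop :=
  ∃ (T : Type w) (P : T → C) (π : ∀ t i, P t ⟶ A i),
    ∀ (X : C) (f : ∀ i, X ⟶ A i), ∃ (t : T) (h : X ⟶ P t), ∀ i, h ≫ π t i = f i

/-- `C` (with finite products) is cartesian multi-closed: each functor `A × -` is a
left multi-adjoint. -/
def CartesianMultiClosedOf (C : Type u₁) [Category.{v₁} C] [HasFiniteProducts C] : Prop :=
  ∀ A B : C, ∃ (I : Type v₁) (E : I → C) (ev : ∀ i, A ⨯ E i ⟶ B),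
    ∀ (X : C) (c : A ⨯ X ⟶ B),
      ∃ p : Σ i : I, X ⟶ E i, (prod.map (𝟙 A) p.2 ≫ ev p.1 = c) ∧
        ∀ q : Σ i : I, X ⟶ E i, prod.map (𝟙 A) q.2 ≫ ev q.1 = c → q = p

/-- `C` is cartesian multi-closed: it has finite products and each functor `A × -` is a
left multi-adjoint. -/
def CartesianMultiClosed (C : Type u₁) [Category.{v₁} C] : Prop :=
  ∃ h : HasFiniteProducts C, @CartesianMultiClosedOf C _ h

/-- `C` is cartesian closed (as a property: it has finite products and each `A × -`
is a left adjoint). -/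
def CartesianClosedP (C : Type u₁) [Category.{v₁} C] : Prop :=
  ∃ h : CartesianMonoidalCategory C, Nonempty (@MonoidalClosed C _ h.toMonoidalCategory)

/-- `C` is locally cartesian closed: every slice category is cartesian closed. -/
def LocallyCartesianClosedP (C : Type u₁) [Category.{v₁} C] : Prop :=
  ∀ A : C, CartesianClosedP (Over A)

/-- `C` is locally cartesian multi-closed: every slice category is cartesian multi-closed. -/
def LocallyCartesianMultiClosed (C : Type u₁) [Category.{v₁} C] : Prop :=
  ∀ A : C, CartesianMultiClosed (Over A)

/-- `C` (with finite products) is cartesian pre-closed: each functor `C(A × -, B)`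
is a small presheaf. -/
def CartesianPreClosedOf (C : Type u₁) [Category.{v₁} C] [HasFiniteProducts C] : Prop :=
  ∀ A B : C, IsSmallPresheaf.{w} ((prod.functor.obj A).op ⋙ yoneda.obj B)

/-- `C` is cartesian pre-closed: it has finite products and each functor `C(A × -, B)`
is a small presheaf. -/
def CartesianPreClosed (C : Type u₁) [Category.{v₁} C] : Prop :=
  ∃ h : HasFiniteProducts C, @CartesianPreClosedOf.{w} C _ h

/-- `C` (with binary products) has weak simple products. -/
def HasWeakSimpleProductsOf (C : Type u₁) [Category.{v₁} C] [HasBinaryProducts C] : Prop :=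
  ∀ (A X B : C) (b : B ⟶ A ⨯ X),
    ∃ (P : C) (ε : A ⨯ P ⟶ B) (w : P ⟶ X),
      ε ≫ b = prod.map (𝟙 A) w ∧
      ∀ (P' : C) (ε' : A ⨯ P' ⟶ B) (w' : P' ⟶ X), ε' ≫ b = prod.map (𝟙 A) w' →
        ∃ f : P' ⟶ P, ε' = prod.map (𝟙 A) f ≫ ε ∧ w' = f ≫ w

/-- `C` has binary products and weak simple products. -/
def HasWeakSimpleProducts (C : Type u₁) [Category.{v₁} C] : Prop :=
  ∃ h : HasBinaryProducts C, @HasWeakSimpleProductsOf C _ h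

/-- `C` has a subobject classifier: a mono `ε : 1 ⟶ Ω` from the terminal object such that
every monomorphism is a pullback of `ε` along a unique morphism. -/
def HasSubobjectClassifierP (C : Type u₁) [Category.{v₁} C] : Prop :=
  ∃ (T Ω : C) (hT : IsTerminal T) (ε : T ⟶ Ω), Mono ε ∧
    ∀ ⦃U X : C⦄ (m : U ⟶ X), Mono m → ∃! χ : X ⟶ Ω, IsPullback (hT.from U) m ε χ

/-- `C` is an elementary topos: finitely complete, cartesian closed,
with a subobject classifier. -/
def IsElementaryTopos (C : Type u₁) [Category.{v₁} C] : Prop :=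
  HasFiniteLimits C ∧ CartesianClosedP C ∧ HasSubobjectClassifierP C

/-- `C` is a multi-topos: finitely complete, cartesian multi-closed,
with a subobject classifier. -/
def IsMultiTopos (C : Type u₁) [Category.{v₁} C] : Prop :=
  HasFiniteLimits C ∧ CartesianMultiClosed C ∧ HasSubobjectClassifierP C

/-- A coproduct cocone is *universal*: it is stable under pullback. -/
def CofanUniversal {C : Type u₁} [Category.{v₁} C] {I : Type w₁} {X : I → C}
    (c : Cofan X) : Prop :=
  ∀ {W : C} (h : W ⟶ c.pt) (Y : I → C) (p : ∀ i, Y i ⟶ W) (q : ∀ i, Y i ⟶ X i),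
    (∀ i, IsPullback (p i) (q i) h (c.inj i)) → Nonempty (IsColimit (Cofan.mk W p))

/-- A coproduct cocone is *disjoint*: injections are monic with initial pairwise
intersections. -/
def CofanDisjoint {C : Type u₁} [Category.{v₁} C] {I : Type w₁} {X : I → C}
    (c : Cofan X) : Prop :=
  (∀ i, Mono (c.inj i)) ∧
    ∀ i j, i ≠ j → ∀ {Z : C} (u : Z ⟶ X i) (v : Z ⟶ X j),
      IsPullback u v (c.inj i) (c.inj j) → Nonempty (IsInitial Z)

/-- `C` is extensive: finitely complete, with finite coproducts which are
universal and disjoint. -/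
def IsExtensive (C : Type u₁) [Category.{v₁} C] : Prop :=
  HasFiniteLimits C ∧ HasFiniteCoproducts C ∧
    ∀ (I : Type) [Finite I] (X : I → C) (c : Cofan X),
      Nonempty (IsColimit c) → CofanUniversal c ∧ CofanDisjoint c

/-- `C` is infinitary extensive: finitely complete, with small (`Type w`-indexed)
coproducts which are universal and disjoint. -/
def IsInfinitaryExtensive (C : Type u₁) [Category.{v₁} C] : Prop :=
  HasFiniteLimits C ∧ HasCoproducts.{w} C ∧
    ∀ (I : Type w) (X : I → C) (c : Cofan X),
      Nonempty (IsColimit c) → CofanUniversal c ∧ CofanDisjoint c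

/-- A parallel pair `r₁ r₂ : R ⟶ X` is an (internal) equivalence relation. -/
structure IsEquivalenceRelationPair {C : Type u₁} [Category.{v₁} C] {R X : C}
    (r₁ r₂ : R ⟶ X) : Prop where
  jointlyMono : ∀ {Z : C} (a b : Z ⟶ R), a ≫ r₁ = b ≫ r₁ → a ≫ r₂ = b ≫ r₂ → a = b
  refl : ∀ {Z : C} (f : Z ⟶ X), ∃ d : Z ⟶ R, d ≫ r₁ = f ∧ d ≫ r₂ = f
  symm : ∃ s : R ⟶ R, s ≫ r₁ = r₂ ∧ s ≫ r₂ = r₁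
  trans : ∀ {Z : C} (a b : Z ⟶ R), a ≫ r₂ = b ≫ r₁ →
    ∃ t : Z ⟶ R, t ≫ r₁ = a ≫ r₁ ∧ t ≫ r₂ = b ≫ r₂

/-- `C` is a regular category: finitely complete, with (regular epi, mono)
factorizations, and regular epimorphisms are stable under pullback. -/
def IsRegularCat (C : Type u₁) [Category.{v₁} C] : Prop :=
  HasFiniteLimits C ∧
    (∀ {X Y : C} (f : X ⟶ Y), ∃ (Z : C) (e : X ⟶ Z) (m : Z ⟶ Y),
      e ≫ m = f ∧ Nonempty (RegularEpi e) ∧ Mono m) ∧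
    (∀ {P X Y Z : C} (fst : P ⟶ X) (snd : P ⟶ Y) (f : X ⟶ Z) (g : Y ⟶ Z),
      IsPullback fst snd f g → Nonempty (RegularEpi g) → Nonempty (RegularEpi fst))

/-- `C` is an exact (Barr-exact) category: regular with effective equivalence relations. -/
def IsExactCat (C : Type u₁) [Category.{v₁} C] : Prop :=
  IsRegularCat C ∧
    ∀ {R X : C} (r₁ r₂ : R ⟶ X), IsEquivalenceRelationPair r₁ r₂ →
      ∃ (Y : C) (f : X ⟶ Y), IsPullback r₁ r₂ f f

/-- A pretopos is an exact and extensive category. -/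
def IsPretopos (C : Type u₁) [Category.{v₁} C] : Prop :=
  IsExactCat C ∧ IsExtensive C

/-- `C` is additive: preadditive with finite biproducts. -/
def IsAdditive (C : Type u₁) [Category.{v₁} C] : Prop :=
  ∃ p : Preadditive C, letI := p; HasFiniteBiproducts C

/-- `C` is wellpowered: every object has only a set of subobjects. -/
def Wellpowered (C : Type u₁) [Category.{v₁} C] : Prop :=
  ∀ X : C, Small.{w} (Subobject X)

/-- `C` is cowellpowered: every object has only a set of quotient objects. -/
def Cowellpowered (C : Type u₁) [Category.{v₁} C] : Prop :=
  ∀ X : C, Small.{w} (Subobject (Opposite.op X))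

/-- `C` has a clique-like class of objects, indexed by all ordinals. -/
def HasCliqueLikeClass (C : Type u₁) [Category.{v₁} C] : Prop :=
  ∃ (A : Ordinal.{v₁} → C) (R : MorphismProperty C),
    (∀ {X Y Z : C} (v : X ⟶ Y) (u : Y ⟶ Z), R (v ≫ u) → R u) ∧
    (∀ k, ∃ f g : A 0 ⟶ A k, f ≠ g ∧ R f ∧ R g) ∧
    ((∀ i k : Ordinal.{v₁}, 0 < i → i < k → ∀ f : A k ⟶ A i, ¬ R f) ∨
     (∀ k i : Ordinal.{v₁}, 0 < k → k < i → ∀ f : A k ⟶ A i, ¬ R f))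

/-- A presheaf is petty: a quotient of a small coproduct of representables. -/
def IsPetty {C : Type u₁} [Category.{v₁} C] (F : Cᵒᵖ ⥤ Type v₁) : Prop :=
  ∃ (I : Type v₁) (A : I → C) (e : (∐ fun i => yoneda.obj (A i)) ⟶ F), Epi e

/-- A presheaf is lucid: petty, and equalizers of pairs of morphisms from petty
presheaves into it are petty. -/
noncomputable def IsLucid {C : Type u₁} [Category.{v₁} C] (F : Cᵒᵖ ⥤ Type v₁) : Prop :=
  IsPetty F ∧ ∀ (P : Cᵒᵖ ⥤ Type v₁), IsPetty P → ∀ u₁ u₂ : P ⟶ F, IsPetty (equalizer u₁ u₂)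

universe v u

/-- A small set of cones weakly covering a binary relation on generalized elements. -/
def SmallCov.{w', v', u'} {K : Type u'} [Category.{v'} K] {X Y : K}
    (R : ∀ Z : K, (Z ⟶ X) → (Z ⟶ Y) → Prop) : Prop :=
  ∃ (T : Type w') (A : T → K) (p : ∀ t, A t ⟶ X) (q : ∀ t, A t ⟶ Y),
    (∀ t, R _ (p t) (q t)) ∧
    ∀ (Z : K) (f : Z ⟶ X) (g : Z ⟶ Y), R Z f g →
      ∃ (t : T) (h : Z ⟶ A t), h ≫ p t = f ∧ h ≫ q t = g

/-- A presheaf has a small set of generators. -/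
def Gens.{w', v', u'} {K : Type u'} [Category.{v'} K] (F : Kᵒᵖ ⥤ Type v') : Prop :=
  ∃ (T : Type w') (A : T → K) (x : ∀ t, F.obj (Opposite.op (A t))),
    ∀ (X : K) (y : F.obj (Opposite.op X)), ∃ (t : T) (f : X ⟶ A t), F.map f.op (x t) = y

/-- All the fibre products of representables over `F` have small sets of generators. -/
def Rels.{w', v', u'} {K : Type u'} [Category.{v'} K] (F : Kᵒᵖ ⥤ Type v') : Prop :=
  ∀ (X Y : K) (x : F.obj (Opposite.op X)) (y : F.obj (Opposite.op Y)),
    SmallCov.{w'} (fun (Z : K) (f : Z ⟶ X) (g : Z ⟶ Y) => F.map f.op x = F.map g.op y)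

/-- Pre-limits of families of spans with common feet. -/
def WidePre.{w', v', u'} (K : Type u') [Category.{v'} K] (ι : Type w') : Prop :=
  ∀ (P : ι → K) (X Y : K) (p : ∀ j, P j ⟶ X) (q : ∀ j, P j ⟶ Y),
    ∃ (T : Type v') (Z : T → K) (h : ∀ t j, Z t ⟶ P j) (f : ∀ t, Z t ⟶ X) (g : ∀ t, Z t ⟶ Y),
      (∀ t j, h t j ≫ p j = f t) ∧ (∀ t j, h t j ≫ q j = g t) ∧
      ∀ (Z' : K) (h' : ∀ j, Z' ⟶ P j) (f' : Z' ⟶ X) (g' : Z' ⟶ Y),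
        (∀ j, h' j ≫ p j = f') → (∀ j, h' j ≫ q j = g') →
        ∃ (t : T) (k : Z' ⟶ Z t), (∀ j, k ≫ h t j = h' j) ∧ k ≫ f t = f' ∧ k ≫ g t = g'

theorem map_map_apply {K : Type u} [Category.{v} K] (F : Kᵒᵖ ⥤ Type v) {X Y Z : K}
    (f : X ⟶ Y) (g : Y ⟶ Z) (x : F.obj (Opposite.op Z)) :
    F.map f.op (F.map g.op x) = F.map (f ≫ g).op x := by
  simp

/-- A presheaf with small sets of generators and relations is small. -/
theorem isSmall_of_gens_rels {K : Type u} [Category.{v} K] (F : Kᵒᵖ ⥤ Type v)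
    (hG : Gens.{v} F) (hR : Rels.{v} F) : IsSmallPresheaf.{v} F := by
  obtain ⟨T, A, x, hx⟩ := hG
  choose S P p q hpq hS using fun t t' : T => hR (A t) (A t') (x t) (x t')
  let J : MultispanShape.{v, v} :=
    { L := Σ t t', S t t'
      R := T
      fst := fun s => s.1
      snd := fun s => s.2.1 }
  let I : MultispanIndex J K :=
    { left := fun s => P s.1 s.2.1 s.2.2
      right := A
      fst := fun s => p s.1 s.2.1 s.2.2
      snd := fun s => q s.1 s.2.1 s.2.2 }
  let c : Cocone (I.multispan ⋙ yoneda) :=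
    { pt := F
      ι :=
        { app := fun j => match j with
            | .left s => yonedaEquiv.symm (F.map (p s.1 s.2.1 s.2.2).op (x s.1))
            | .right t => yonedaEquiv.symm (x t)
          naturality := by
            rintro _ _ (_ | s | s)
            · simp
            · dsimp
              rw [Category.comp_id]
              exact yonedaEquiv_symm_naturality_left _ _ _
            · dsimp
              rw [Category.comp_id, hpq]
              exact yonedaEquiv_symm_naturality_left _ _ _ } }
  have hc : ∀ (t : T) (Z : K) (f : Z ⟶ A t),
      (c.ι.app (WalkingMultispan.right t)).app (Opposite.op Z) f = F.map f.op (x t) :=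
    fun t Z f => rfl
  refine ⟨WalkingMultispan J, inferInstance, I.multispan, c, ⟨?_⟩, ⟨Iso.refl _⟩⟩
  -- well-definedness
  have wd : ∀ (s : Cocone (I.multispan ⋙ yoneda)) (t t' : T) (Z : K) (f : Z ⟶ A t) (f' : Z ⟶ A t'),
      F.map f.op (x t) = F.map f'.op (x t') →
      (s.ι.app (WalkingMultispan.right t)).app (Opposite.op Z) f =
      (s.ι.app (WalkingMultispan.right t')).app (Opposite.op Z) f' := by
    intro s t t' Z f f' h
    obtain ⟨r, k, h1, h2⟩ := hS t t' Z f f' h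
    have e1 := s.w (WalkingMultispan.Hom.fst (J := J) ⟨t, t', r⟩)
    have e2 := s.w (WalkingMultispan.Hom.snd (J := J) ⟨t, t', r⟩)
    have e3 := ConcreteCategory.congr_hom (congr_arg (fun α => NatTrans.app α (Opposite.op Z)) (e1.trans e2.symm)) k
    rw [← h1, ← h2]
    exact e3
  choose τ φ hφ using hx
  have hnat : ∀ (s : Cocone (I.multispan ⋙ yoneda)) (Z Z' : Kᵒᵖ) (g : Z ⟶ Z'),
      F.map g ≫ (↾fun y => (s.ι.app (WalkingMultispan.right (τ Z'.unop y))).app Z' (φ Z'.unop y)) =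
      (↾fun y => (s.ι.app (WalkingMultispan.right (τ Z.unop y))).app Z (φ Z.unop y)) ≫ s.pt.map g := by
    intro s Z Z' g
    ext y
    have nat := NatTrans.naturality_apply (s.ι.app (WalkingMultispan.right (τ Z.unop y))) g (φ Z.unop y)
    refine Eq.trans ?_ nat
    refine wd s _ _ Z'.unop _ (g.unop ≫ φ Z.unop y) ?_
    rw [hφ, ← map_map_apply, hφ]
    rfl
  let dsc : ∀ s : Cocone (I.multispan ⋙ yoneda), c.pt ⟶ s.pt := fun s =>
    { app := fun Z => ↾fun y => (s.ι.app (WalkingMultispan.right (τ Z.unop y))).app Z (φ Z.unop y)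
      naturality := fun Z Z' g => hnat s Z Z' g }
  refine { desc := dsc, fac := ?_, uniq := ?_ }
  · intro s j
    have right : ∀ t, c.ι.app (WalkingMultispan.right t) ≫ dsc s = s.ι.app (WalkingMultispan.right t) := by
      intro t
      ext Z f
      refine wd s _ _ Z.unop _ _ ?_
      rw [hφ]
      exact hc t Z.unop f
    rcases j with r | t
    · rw [← c.w (WalkingMultispan.Hom.fst r), ← s.w (WalkingMultispan.Hom.fst r), Category.assoc,
        right]
    · exact right t
  · intro s m hm
    ext Z y
    have h1 := hm (WalkingMultispan.right (τ Z.unop y))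
    have h2 := ConcreteCategory.congr_hom (congr_arg (fun α => NatTrans.app α Z) h1) (φ Z.unop y)
    refine Eq.trans ?_ h2
    have h3 := hφ Z.unop y
    rw [← hc] at h3
    exact congr_arg (m.app Z) h3.symm

theorem gens_of_isSmall {K : Type u} [Category.{v} K] (F : Kᵒᵖ ⥤ Type v)
    (h : IsSmallPresheaf.{v} F) : Gens.{v} F := by
  obtain ⟨J, _, D, c, ⟨hc⟩, ⟨e⟩⟩ := h
  refine ⟨J, D.obj, fun j => yonedaEquiv (c.ι.app j ≫ e.hom), fun X y => ?_⟩
  obtain ⟨j, f, hf⟩ := Types.jointly_surjective_of_isColimit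
    (isColimitOfPreserves ((evaluation Kᵒᵖ (Type v)).obj (Opposite.op X)) hc)
    (e.inv.app (Opposite.op X) y)
  refine ⟨j, f, ?_⟩
  rw [map_yonedaEquiv]
  have := congr_arg (e.hom.app (Opposite.op X)) hf
  refine Eq.trans this ?_
  simp

/-- Formal zigzags. -/
inductive Zig {J : Type v} [SmallCategory J] : J → J → Type v
  | rel {i j : J} (u : i ⟶ j) : Zig i j
  | refl (i : J) : Zig i i
  | symm {i j : J} (z : Zig i j) : Zig j i
  | trans {i j k : J} (z : Zig i j) (z' : Zig j k) : Zig i k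

/-- The relation given by a zigzag. -/
def Zig.R {K : Type u} [Category.{v} K] {J : Type v} [SmallCategory J] (D : J ⥤ K) :
    ∀ {i j : J}, Zig i j → ∀ Z : K, (Z ⟶ D.obj i) → (Z ⟶ D.obj j) → Prop
  | _, _, .rel u, _, f, g => f ≫ D.map u = g
  | _, _, .refl _, _, f, g => f = g
  | _, _, .symm z, Z, f, g => z.R D Z g f
  | _, _, .trans z z', Z, f, g => ∃ h, z.R D Z f h ∧ z'.R D Z h g

/-- Pre-pullbacks. -/
theorem prePullback {K : Type u} [Category.{v} K] (hK : FinitelyPreComplete K) {X Y B : K}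
    (a : X ⟶ B) (b : Y ⟶ B) :
    SmallCov.{v} (fun (Z : K) (f : Z ⟶ X) (g : Z ⟶ Y) => f ≫ a = g ≫ b) := by
  obtain ⟨T, c, hc⟩ := hK WalkingCospan (cospan a b)
  refine ⟨T, fun t => (c t).pt, fun t => (c t).π.app WalkingCospan.left,
    fun t => (c t).π.app WalkingCospan.right, fun t => PullbackCone.condition (c t), ?_⟩
  intro Z f g h
  obtain ⟨t, ⟨m⟩⟩ := hc (PullbackCone.mk f g h)
  exact ⟨t, m.hom, m.w WalkingCospan.left, m.w WalkingCospan.right⟩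

theorem Zig.R_precomp {K : Type u} [Category.{v} K] {J : Type v} [SmallCategory J] (D : J ⥤ K)
    {i j : J} (z : Zig i j) : ∀ {Z Z' : K} (k : Z' ⟶ Z) (f : Z ⟶ D.obj i) (g : Z ⟶ D.obj j),
      z.R D Z f g → z.R D Z' (k ≫ f) (k ≫ g) := by
  induction z with
  | rel u => intro Z Z' k f g h; simp only [Zig.R] at h ⊢; simp [← h]
  | refl i => intro Z Z' k f g h; simp only [Zig.R] at h ⊢; simp [← h]
  | symm z ih => intro Z Z' k f g h; exact ih k g f h
  | trans z z' ih ih' =>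
    intro Z Z' k f g h
    obtain ⟨h, h1, h2⟩ := h
    exact ⟨k ≫ h, ih k f h h1, ih' k h g h2⟩

theorem Zig.cov {K : Type u} [Category.{v} K] (hK : FinitelyPreComplete K)
    {J : Type v} [SmallCategory J] (D : J ⥤ K)
    {i j : J} (z : Zig i j) : SmallCov.{v} (z.R D) := by
  induction z with
  | @rel i j u =>
    refine ⟨PUnit, fun _ => D.obj i, fun _ => 𝟙 _, fun _ => D.map u, fun _ => ?_, ?_⟩
    · simp [Zig.R]
    · intro Z f g h
      exact ⟨⟨⟩, f, by simp, h⟩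
  | refl i =>
    refine ⟨PUnit, fun _ => D.obj i, fun _ => 𝟙 _, fun _ => 𝟙 _, fun _ => ?_, ?_⟩
    · simp [Zig.R]
    · intro Z f g h
      exact ⟨⟨⟩, f, by simp, (Category.comp_id f).trans h⟩
  | symm z ih =>
    obtain ⟨T, A, p, q, h1, h2⟩ := ih
    refine ⟨T, A, q, p, h1, fun Z f g h => ?_⟩
    obtain ⟨t, k, e1, e2⟩ := h2 Z g f h
    exact ⟨t, k, e2, e1⟩
  | trans z z' ih ih' =>
    obtain ⟨T, A, p, q, h1, h2⟩ := ih
    obtain ⟨T', A', p', q', h1', h2'⟩ := ih'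
    choose S B a b hab hS using fun (t : T) (t' : T') => prePullback hK (q t) (p' t')
    refine ⟨Σ t t', S t t', fun s => B s.1 s.2.1 s.2.2, fun s => a s.1 s.2.1 s.2.2 ≫ p s.1,
      fun s => b s.1 s.2.1 s.2.2 ≫ q' s.2.1, fun s => ?_, ?_⟩
    · refine ⟨a s.1 s.2.1 s.2.2 ≫ q s.1, Zig.R_precomp D z _ _ _ (h1 _), ?_⟩
      rw [hab]
      exact Zig.R_precomp D z' _ _ _ (h1' _)
    · rintro Z f g ⟨h, e1, e2⟩
      obtain ⟨t, k, r1, r2⟩ := h2 Z f h e1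
      obtain ⟨t', k', r1', r2'⟩ := h2' Z h g e2
      obtain ⟨s, l, l1, l2⟩ := hS t t' Z k k' (r2.trans r1'.symm)
      refine ⟨⟨t, t', s⟩, l, ?_, ?_⟩
      · dsimp only
        rw [← Category.assoc, l1, r1]
      · dsimp only
        rw [← Category.assoc, l2, r2']

theorem Zig.sound {K : Type u} [Category.{v} K] {J : Type v} [SmallCategory J] {D : J ⥤ K}
    (c : Cocone (D ⋙ yoneda)) {i j : J} (z : Zig i j) :
    ∀ (Z : K) (f : Z ⟶ D.obj i) (g : Z ⟶ D.obj j), z.R D Z f g →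
      (c.ι.app i).app (Opposite.op Z) f = (c.ι.app j).app (Opposite.op Z) g := by
  induction z with
  | rel u =>
    intro Z f g h
    simp only [Zig.R] at h
    rw [← c.w u, ← h]
    rfl
  | refl i => intro Z f g h; simp only [Zig.R] at h; rw [h]
  | symm z ih => intro Z f g h; exact (ih Z g f h).symm
  | trans z z' ih ih' =>
    rintro Z f g ⟨h, h1, h2⟩
    exact (ih Z f h h1).trans (ih' Z h g h2)

theorem Zig.complete {K : Type u} [Category.{v} K] {J : Type v} [SmallCategory J] {D : J ⥤ K}
    (c : Cocone (D ⋙ yoneda)) (hc : IsColimit c) {i j : J} (Z : K)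
    (f : Z ⟶ D.obj i) (g : Z ⟶ D.obj j)
    (h : (c.ι.app i).app (Opposite.op Z) f = (c.ι.app j).app (Opposite.op Z) g) :
    ∃ z : Zig i j, z.R D Z f g := by
  let ev := (evaluation Kᵒᵖ (Type v)).obj (Opposite.op Z)
  let G : J ⥤ Type v := (D ⋙ yoneda) ⋙ ev
  have hc' : IsColimit (ev.mapCocone c) := isColimitOfPreserves ev hc
  have key : colimit.ι G i f = colimit.ι G j g := by
    have e := fun j => IsColimit.comp_coconePointUniqueUpToIso_hom hc' (colimit.isColimit G) j
    have e1 := congr_arg (fun α => α f) (e i)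
    have e2 := congr_arg (fun α => α g) (e j)
    refine e1.symm.trans (Eq.trans ?_ e2)
    exact congr_arg (hc'.coconePointUniqueUpToIso (colimit.isColimit G)).hom h
  have gen := Types.colimit_eq key
  have main : ∀ a b : (Σ j, G.obj j), Relation.EqvGen G.ColimitTypeRel a b →
      ∃ z : Zig a.1 b.1, z.R D Z a.2 b.2 := by
    intro a b h
    induction h with
    | rel a b h =>
      obtain ⟨u, hu⟩ := h
      exact ⟨.rel u, hu.symm⟩
    | refl a => exact ⟨.refl _, rfl⟩
    | symm a b _ ih => obtain ⟨z, hz⟩ := ih; exact ⟨.symm z, hz⟩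
    | trans a b c _ _ ih ih' =>
      obtain ⟨z, hz⟩ := ih
      obtain ⟨z', hz'⟩ := ih'
      exact ⟨.trans z z', b.2, hz, hz'⟩
  exact main _ _ gen

/-- Change of base for `SmallCov`. -/
theorem SmallCov.baseChange {K : Type u} [Category.{v} K] (hK : FinitelyPreComplete K)
    {X Y X' Y' : K} {R : ∀ Z : K, (Z ⟶ X) → (Z ⟶ Y) → Prop}
    (hR : ∀ {Z Z' : K} (k : Z' ⟶ Z) (f : Z ⟶ X) (g : Z ⟶ Y), R Z f g → R Z' (k ≫ f) (k ≫ g))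
    (h : SmallCov.{v} R) (a : X' ⟶ X) (b : Y' ⟶ Y) :
    SmallCov.{v} (fun (Z : K) (f : Z ⟶ X') (g : Z ⟶ Y') => R Z (f ≫ a) (g ≫ b)) := by
  obtain ⟨T, A, p, q, h1, h2⟩ := h
  choose S B c d hcd hS using fun t : T => prePullback hK (p t) a
  choose S' B' c' d' hcd' hS' using fun (t : T) (s : S t) => prePullback hK (c t s ≫ q t) b
  refine ⟨Σ t s, S' t s, fun s => B' s.1 s.2.1 s.2.2, fun s => c' _ _ s.2.2 ≫ d _ s.2.1,
    fun s => d' _ _ s.2.2, ?_, ?_⟩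
  · rintro ⟨t, s, s'⟩
    dsimp only
    rw [Category.assoc, ← hcd, ← hcd', ← Category.assoc, ← Category.assoc]
    exact hR _ _ _ (h1 t)
  · intro Z f g hfg
    obtain ⟨t, k, e1, e2⟩ := h2 Z _ _ hfg
    obtain ⟨s, l, l1, l2⟩ := hS t Z k f e1
    obtain ⟨s', m, m1, m2⟩ := hS' t s Z l g (by dsimp only; rw [← Category.assoc, l1, e2])
    refine ⟨⟨t, s, s'⟩, m, ?_, m2⟩
    dsimp only
    rw [← Category.assoc, m1, l2]

theorem rels_of_isSmall {K : Type u} [Category.{v} K] (hK : FinitelyPreComplete K)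
    (F : Kᵒᵖ ⥤ Type v) (h : IsSmallPresheaf.{v} F) : Rels.{v} F := by
  obtain ⟨J, _, D, c, ⟨hc⟩, ⟨e⟩⟩ := h
  -- replace the cocone by one with point `F`
  let c' : Cocone (D ⋙ yoneda) := c.extend e.hom
  have hc' : IsColimit c' := IsColimit.extendIso e.hom hc
  have surj : ∀ (X : K) (y : F.obj (Opposite.op X)), ∃ (j : J) (f : X ⟶ D.obj j),
      (c'.ι.app j).app (Opposite.op X) f = y := fun X y =>
    Types.jointly_surjective_of_isColimit
      (isColimitOfPreserves ((evaluation Kᵒᵖ (Type v)).obj (Opposite.op X)) hc') y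
  intro X Y x y
  obtain ⟨i, a, rfl⟩ := surj X x
  obtain ⟨j, b, rfl⟩ := surj Y y
  have nat : ∀ {i : J} {X Z : K} (f : Z ⟶ X) (a : X ⟶ D.obj i),
      F.map f.op ((c'.ι.app i).app (Opposite.op X) a) =
        (c'.ι.app i).app (Opposite.op Z) (f ≫ a) := by
    intro i X Z f a
    exact (NatTrans.naturality_apply (c'.ι.app i) f.op a).symm
  choose T A p q h1 h2 using fun z : Zig i j =>
    SmallCov.baseChange hK (fun k f g => Zig.R_precomp D z k f g) (Zig.cov hK D z) a b
  refine ⟨Σ z, T z, fun s => A s.1 s.2, fun s => p s.1 s.2, fun s => q s.1 s.2, ?_, ?_⟩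
  · rintro ⟨z, t⟩
    dsimp only
    rw [nat, nat]
    exact Zig.sound c' z _ _ _ (h1 z t)
  · intro Z f g h
    rw [nat, nat] at h
    obtain ⟨z, hz⟩ := Zig.complete c' hc' Z _ _ h
    obtain ⟨t, k, e1, e2⟩ := h2 z Z f g hz
    exact ⟨⟨z, t⟩, k, e1, e2⟩

section Limits

variable {K : Type u} [Category.{v} K] {J : Type w} [Category.{w₁} J]
  {D : J ⥤ (Kᵒᵖ ⥤ Type v)} {c : Cone D} (hc : IsLimit c)

theorem cone_nat (c : Cone D) (j : J) {X Y : K} (f : Y ⟶ X) (x : c.pt.obj (Opposite.op X)) :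
    (c.π.app j).app (Opposite.op Y) (c.pt.map f.op x) =
      (D.obj j).map f.op ((c.π.app j).app (Opposite.op X) x) :=
  NatTrans.naturality_apply (c.π.app j) f.op x

theorem limit_ext (hc : IsLimit c) {X : K} (x y : c.pt.obj (Opposite.op X))
    (h : ∀ j, (c.π.app j).app _ x = (c.π.app j).app _ y) : x = y := by
  apply yonedaEquiv.symm.injective
  refine hc.hom_ext fun j => ?_
  rw [yonedaEquiv_symm_naturality_right, yonedaEquiv_symm_naturality_right, h]

theorem limit_lift (hc : IsLimit c) {X : K} (x : ∀ j, (D.obj j).obj (Opposite.op X))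
    (hx : ∀ {j j'} (u : j ⟶ j'), (D.map u).app _ (x j) = x j') :
    ∃ y : c.pt.obj (Opposite.op X), ∀ j, (c.π.app j).app _ y = x j := by
  let s : Cone D :=
    { pt := yoneda.obj X
      π :=
        { app := fun j => yonedaEquiv.symm (x j)
          naturality := by
            intro j j' u
            rw [yonedaEquiv_symm_naturality_right, hx]
            exact Category.id_comp _ } }
  refine ⟨yonedaEquiv (hc.lift s), fun j => ?_⟩
  rw [← yonedaEquiv_comp, hc.fac]
  exact yonedaEquiv.apply_symm_apply _

theorem rels_limit (hc : IsLimit c) (hW : WidePre K J) (hD : ∀ j, Rels.{v} (D.obj j)) :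
    Rels.{max w v} c.pt := by
  intro X Y x y
  choose T A p q h1 h2 using fun j =>
    hD j X Y ((c.π.app j).app _ x) ((c.π.app j).app _ y)
  choose S B h f g hf hg hu using fun τ : (∀ j, T j) =>
    hW (fun j => A j (τ j)) X Y (fun j => p j (τ j)) (fun j => q j (τ j))
  refine ⟨Σ τ, S τ, fun s => B s.1 s.2, fun s => f s.1 s.2, fun s => g s.1 s.2, ?_, ?_⟩
  · rintro ⟨τ, s⟩
    refine limit_ext hc _ _ fun j => ?_
    dsimp only
    rw [cone_nat, cone_nat]
    rw [← hf τ s j, ← hg τ s j, ← map_map_apply, ← map_map_apply, h1]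
  · intro Z a b hab
    have : ∀ j, ∃ (t : T j) (k : Z ⟶ A j t), k ≫ p j t = a ∧ k ≫ q j t = b := by
      intro j
      refine h2 j Z a b ?_
      dsimp only
      rw [← cone_nat, ← cone_nat, hab]
    choose τ k hk1 hk2 using this
    obtain ⟨s, m, _, m1, m2⟩ := hu τ Z k a b hk1 hk2
    exact ⟨⟨τ, s⟩, m, m1, m2⟩

end Limits

theorem gens_prod {K : Type u} [Category.{v} K] {ι : Type w}
    (hP : ∀ A : ι → K, HasPreProduct.{v} A)
    {D : Discrete ι ⥤ (Kᵒᵖ ⥤ Type v)} {c : Cone D} (hc : IsLimit c)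
    (hD : ∀ j, Gens.{v} (D.obj j)) : Gens.{max w v} c.pt := by
  choose T A x hx using fun j : ι => hD ⟨j⟩
  choose S P π hπ using fun τ : (∀ j, T j) => hP (fun j => A j (τ j))
  have : ∀ (τ : ∀ j, T j) (s : S τ), ∃ y : c.pt.obj (Opposite.op (P τ s)),
      ∀ j, (c.π.app j).app _ y = (D.obj j).map (π τ s j.as).op (x j.as (τ j.as)) := by
    intro τ s
    refine limit_lift hc _ ?_
    rintro ⟨j⟩ ⟨j'⟩ u
    obtain rfl := Discrete.eq_of_hom u
    obtain rfl : u = 𝟙 _ := Subsingleton.elim _ _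
    simp
  choose y hy using this
  refine ⟨Σ τ, S τ, fun s => P s.1 s.2, fun s => y s.1 s.2, fun X z => ?_⟩
  choose τ f hf using fun j : ι => hx j X ((c.π.app ⟨j⟩).app _ z)
  obtain ⟨s, h, hh⟩ := hπ τ X f
  refine ⟨⟨τ, s⟩, h, ?_⟩
  refine limit_ext hc _ _ fun j => ?_
  dsimp only
  rw [cone_nat, hy, map_map_apply, hh, hf]

/-- Pre-equalizers. -/
theorem preEqualizer {K : Type u} [Category.{v} K] (hK : FinitelyPreComplete K) {X Y : K}
    (a b : X ⟶ Y) : ∃ (T : Type v) (E : T → K) (e : ∀ t, E t ⟶ X), (∀ t, e t ≫ a = e t ≫ b) ∧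
      ∀ (Z : K) (f : Z ⟶ X), f ≫ a = f ≫ b → ∃ (t : T) (h : Z ⟶ E t), h ≫ e t = f := by
  obtain ⟨T, c, hc⟩ := hK WalkingParallelPair (parallelPair a b)
  refine ⟨T, fun t => (c t).pt, fun t => (c t).π.app WalkingParallelPair.zero,
    fun t => Fork.condition (c t), ?_⟩
  intro Z f h
  obtain ⟨t, ⟨m⟩⟩ := hc (Fork.ofι f h)
  exact ⟨t, m.hom, m.w WalkingParallelPair.zero⟩

theorem gens_equalizer {K : Type u} [Category.{v} K] (hK : FinitelyPreComplete K)
    {D : WalkingParallelPair ⥤ (Kᵒᵖ ⥤ Type v)} {c : Cone D} (hc : IsLimit c)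
    (hG : Gens.{v} (D.obj .zero)) (hR : Rels.{v} (D.obj .one)) : Gens.{v} c.pt := by
  obtain ⟨T, A, x, hx⟩ := hG
  choose S P p q hpq hS using fun t : T => hR (A t) (A t)
    ((D.map WalkingParallelPairHom.left).app _ (x t))
    ((D.map WalkingParallelPairHom.right).app _ (x t))
  choose U E e he hE using fun (t : T) (s : S t) => preEqualizer hK (p t s) (q t s)
  have : ∀ (t : T) (s : S t) (r : U t s), ∃ y : c.pt.obj (Opposite.op (E t s r)),
      (c.π.app .zero).app _ y = (D.obj .zero).map (e t s r ≫ p t s).op (x t) := by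
    intro t s r
    have key : (D.map WalkingParallelPairHom.left).app _
          ((D.obj .zero).map (e t s r ≫ p t s).op (x t)) =
        (D.map WalkingParallelPairHom.right).app _
          ((D.obj .zero).map (e t s r ≫ p t s).op (x t)) := by
      rw [NatTrans.naturality_apply, NatTrans.naturality_apply, ← map_map_apply, hpq,
        map_map_apply, ← he]
    obtain ⟨y, hy⟩ := limit_lift hc
      (X := E t s r)
      (fun j => match j with
        | .zero => (D.obj .zero).map (e t s r ≫ p t s).op (x t)
        | .one => (D.map WalkingParallelPairHom.left).app _
            ((D.obj .zero).map (e t s r ≫ p t s).op (x t)))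
      (by
        rintro j _ (_ | _ | _)
        · rfl
        · exact key.symm
        · exact ConcreteCategory.congr_hom (congr_arg (fun α => NatTrans.app α _) (D.map_id _)) _)
    exact ⟨y, hy .zero⟩
  choose y hy using this
  refine ⟨Σ t s, U t s, fun s => E s.1 s.2.1 s.2.2, fun s => y s.1 s.2.1 s.2.2, fun X z => ?_⟩
  obtain ⟨t, f, hf⟩ := hx X ((c.π.app .zero).app _ z)
  have hw : ∀ {j : WalkingParallelPair} (u : WalkingParallelPair.zero ⟶ j),
      (D.map u).app _ ((c.π.app .zero).app _ z) = (c.π.app j).app _ z := by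
    intro j u
    rw [← c.w u]
    rfl
  obtain ⟨s, k, k1, k2⟩ := hS t X f f (by
    dsimp only
    rw [← NatTrans.naturality_apply, ← NatTrans.naturality_apply, hf, hw, hw])
  obtain ⟨r, l, hl⟩ := hE t s X k (k1.trans k2.symm)
  refine ⟨⟨t, s, r⟩, l, ?_⟩
  have h0 : (c.π.app .zero).app _ (c.pt.map l.op (y t s r)) = (c.π.app .zero).app _ z := by
    rw [cone_nat, hy, map_map_apply, ← Category.assoc, hl, k1, hf]
  refine limit_ext hc _ _ fun j => ?_
  rcases j with _ | _
  · exact h0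
  · rw [← c.w WalkingParallelPairHom.left]
    exact congr_arg ((D.map WalkingParallelPairHom.left).app _) h0

theorem hasPreLimit_of_equiv {K : Type u} [Category.{v} K] {J : Type w} [Category.{w₁} J]
    {J' : Type w₂} [Category.{v₁} J'] (e : J' ≌ J) (D : J ⥤ K)
    (h : HasPreLimit.{v} (e.functor ⋙ D)) : HasPreLimit.{v} D := by
  obtain ⟨T, c, hc⟩ := h
  let E : Cone D ≌ Cone (e.functor ⋙ D) := Cone.whiskeringEquivalence e
  refine ⟨T, fun t => E.inverse.obj (c t), fun s => ?_⟩
  obtain ⟨t, ⟨m⟩⟩ := hc (E.functor.obj s)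
  exact ⟨t, ⟨E.toAdjunction.homEquiv _ _ m⟩⟩

theorem PreComplete.finitely {K : Type u} [Category.{v} K] (h : PreComplete K) :
    FinitelyPreComplete K := by
  intro J _ _ D
  exact hasPreLimit_of_equiv (ULiftHomULiftCategory.equiv.{v, v} J).symm D (h _ _)

/-- The shape of a family of spans with common feet. -/
def spanShape (ι : Type w) : MultispanShape.{w, w} where
  L := ι
  R := ULift.{w} Bool
  fst := fun _ => ⟨false⟩
  snd := fun _ => ⟨true⟩

theorem widePre_of_hasPreLimit {K : Type u} [Category.{v} K] (ι : Type w)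
    (h : ∀ D : WalkingMultispan (spanShape ι) ⥤ K, HasPreLimit.{v} D) :
    WidePre K ι := by
  intro P X Y p q
  let J : MultispanShape.{w, w} := spanShape ι
  let I : MultispanIndex J K :=
    { left := P
      right := fun b => match b with
        | ⟨false⟩ => X
        | ⟨true⟩ => Y
      fst := p
      snd := q }
  obtain ⟨T, c, hc⟩ := h I.multispan
  refine ⟨T, fun t => (c t).pt, fun t j => (c t).π.app (WalkingMultispan.left j),
    fun t => (c t).π.app (WalkingMultispan.right ⟨false⟩),
    fun t => (c t).π.app (WalkingMultispan.right ⟨true⟩),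
    fun t j => (c t).w (WalkingMultispan.Hom.fst (J := J) j),
    fun t j => (c t).w (WalkingMultispan.Hom.snd (J := J) j), ?_⟩
  intro Z' h' f' g' hf hg
  let s : Cone I.multispan :=
    { pt := Z'
      π :=
        { app := fun j => match j with
            | .left j => h' j
            | .right ⟨false⟩ => f'
            | .right ⟨true⟩ => g'
          naturality := by
            rintro _ _ (_ | j | j)
            · simp
            · exact (Category.id_comp _).trans (hf j).symm
            · exact (Category.id_comp _).trans (hg j).symm } }
  obtain ⟨t, ⟨m⟩⟩ := hc s
  exact ⟨t, m.hom, fun j => m.w (.left j), m.w (.right ⟨false⟩), m.w (.right ⟨true⟩)⟩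

theorem hasPreProduct_of_hasPreLimit {K : Type u} [Category.{v} K] {ι : Type w} (A : ι → K)
    (h : HasPreLimit.{v} (Discrete.functor A)) : HasPreProduct.{v} A := by
  obtain ⟨T, c, hc⟩ := h
  refine ⟨T, fun t => (c t).pt, fun t i => (c t).π.app ⟨i⟩, fun X f => ?_⟩
  obtain ⟨t, ⟨m⟩⟩ := hc (Fan.mk X f)
  exact ⟨t, m.hom, fun i => m.w ⟨i⟩⟩

theorem isSmall_yoneda {K : Type u} [Category.{v} K] (X : K) :
    IsSmallPresheaf.{v} (yoneda.obj X) :=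
  ⟨Discrete PUnit.{v + 1}, inferInstance, (Functor.const _).obj X, _,
    ⟨colimitOfDiagramTerminal (X := Discrete.mk PUnit.unit)
      (IsTerminal.ofUniqueHom (fun _ => Discrete.eqToHom rfl) (fun _ _ => Subsingleton.elim _ _)) _⟩,
    ⟨Iso.refl _⟩⟩

theorem hasPreLimit_of_hasLimit {K : Type u} [Category.{v} K] {J : Type w} [Category.{w₁} J]
    [HasLimitsOfShape J (PCompletion K)] (D : J ⥤ K) : HasPreLimit.{v} D := by
  let Y : K ⥤ PCompletion K := ObjectProperty.lift _ yoneda isSmall_yoneda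
  let L := limit (D ⋙ Y)
  obtain ⟨T, A, x, hx⟩ := gens_of_isSmall L.obj L.property
  let π : ∀ j, L.obj ⟶ yoneda.obj (D.obj j) := fun j => (limit.π (D ⋙ Y) j).hom
  have hπ : ∀ {j j'} (u : j ⟶ j'), π j ≫ yoneda.map (D.map u) = π j' := fun u =>
    congr_arg (fun α => α.hom) (limit.w (D ⋙ Y) u)
  let c : T → Cone D := fun t =>
    { pt := A t
      π :=
        { app := fun j => (π j).app _ (x t)
          naturality := by
            intro j j' u
            refine (Category.id_comp _).trans ?_
            rw [← hπ u]
            rfl } }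
  refine ⟨T, c, fun s => ?_⟩
  let s' : Cone (D ⋙ Y) :=
    { pt := Y.obj s.pt
      π :=
        { app := fun j => Y.map (s.π.app j)
          naturality := by
            intro j j' u
            refine (Category.id_comp _).trans ?_
            rw [← s.w u]
            exact Y.map_comp _ _ } }
  let l : yoneda.obj s.pt ⟶ L.obj := (limit.lift (D ⋙ Y) s').hom
  have hl : ∀ j, l ≫ π j = yoneda.map (s.π.app j) := fun j =>
    congr_arg (fun α => α.hom) (limit.lift_π s' j)
  obtain ⟨t, f, hf⟩ := hx s.pt (yonedaEquiv l)
  refine ⟨t, ⟨{ hom := f, w := fun j => ?_ }⟩⟩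
  have h1 : (π j).app _ (L.obj.map f.op (x t)) = f ≫ (π j).app _ (x t) :=
    NatTrans.naturality_apply (π j) f.op (x t)
  refine h1.symm.trans ?_
  rw [hf, ← yonedaEquiv_comp, hl, yonedaEquiv_yoneda_map]

theorem closed_equalizers {K : Type u} [Category.{v} K] (hK : FinitelyPreComplete K)
    (hW : WidePre K WalkingParallelPair) :
    ObjectProperty.IsClosedUnderLimitsOfShape (IsSmallPresheaf.{v} (C := K)) WalkingParallelPair where
  limitsOfShape_le := by
    rintro F ⟨⟨p, hp⟩⟩
    exact isSmall_of_gens_rels F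
      (gens_equalizer hK p.isLimit (gens_of_isSmall _ (hp _)) (rels_of_isSmall hK _ (hp _)))
      (rels_limit.{0} p.isLimit hW (fun j => rels_of_isSmall hK _ (hp j)))

theorem prop_prod {K : Type u} [Category.{v} K] (hK : FinitelyPreComplete K) {ι : Type w}
    (hP : ∀ A : ι → K, HasPreProduct.{v} A) (hW : WidePre K (Discrete ι))
    {D : Discrete ι ⥤ (Kᵒᵖ ⥤ Type v)} {c : Cone D} (hc : IsLimit c)
    (hD : ∀ j, IsSmallPresheaf.{v} (D.obj j)) : Gens.{max w v} c.pt ∧ Rels.{max w v} c.pt :=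
  ⟨gens_prod hP hc (fun j => gens_of_isSmall _ (hD j)),
    rels_limit hc hW (fun j => rels_of_isSmall hK _ (hD j))⟩

theorem FinitelyPreComplete.widePre {K : Type u} [Category.{v} K] (hK : FinitelyPreComplete K)
    (ι : Type) [Fintype ι] : WidePre K ι := by
  classical
  refine widePre_of_hasPreLimit ι fun D => ?_
  have : Fintype (spanShape ι).L := inferInstanceAs (Fintype ι)
  have : Fintype (spanShape ι).R := inferInstanceAs (Fintype (ULift Bool))
  exact hK _ D

/-- Corollary 3.7: `𝒫𝒦` is complete iff `𝒦` is pre-complete, and `𝒫𝒦`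
is finitely complete iff `𝒦` is finitely pre-complete. -/
theorem pCompletion_complete_iff_preComplete (K : Type u) [Category.{v} K] :
    (HasLimitsOfSize.{v, v} (PCompletion K) ↔ PreComplete K) ∧
    (HasFiniteLimits (PCompletion K) ↔ FinitelyPreComplete K) := by
  refine ⟨⟨fun h J _ D => ?_, fun hK => ?_⟩, ⟨fun h J _ _ D => ?_, fun hK => ?_⟩⟩
  · exact hasPreLimit_of_hasLimit D
  · have hF := PreComplete.finitely hK
    have := closed_equalizers hF (hF.widePre _)
    have : ∀ ι : Type v,
        ObjectProperty.IsClosedUnderLimitsOfShape (IsSmallPresheaf.{v} (C := K)) (Discrete ι) := fun ι =>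
      ⟨by
        rintro F ⟨⟨p, hp⟩⟩
        obtain ⟨h1, h2⟩ := prop_prod.{v} hF (fun A => hasPreProduct_of_hasPreLimit A (hK _ _))
          (widePre_of_hasPreLimit _ fun D => hK _ D) p.isLimit hp
        exact isSmall_of_gens_rels _ h1 h2⟩
    have : HasEqualizers (PCompletion K) := hasLimitsOfShape_of_closedUnderLimits _ _
    have : HasProducts.{v} (PCompletion K) := fun ι => hasLimitsOfShape_of_closedUnderLimits _ _
    exact has_limits_of_hasEqualizers_and_products
  · exact hasPreLimit_of_hasLimit D
  · have := closed_equalizers hK (hK.widePre _)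
    have : ∀ n : ℕ,
        ObjectProperty.IsClosedUnderLimitsOfShape (IsSmallPresheaf.{v} (C := K)) (Discrete (Fin n)) := fun n =>
      ⟨by
        rintro F ⟨⟨p, hp⟩⟩
        obtain ⟨h1, h2⟩ := prop_prod.{0} hK (fun A => hasPreProduct_of_hasPreLimit A (hK _ _))
          (hK.widePre _) p.isLimit hp
        exact isSmall_of_gens_rels _ h1 h2⟩
    have : HasEqualizers (PCompletion K) := hasLimitsOfShape_of_closedUnderLimits _ _
    have : HasFiniteProducts (PCompletion K) :=
      ⟨fun n => hasLimitsOfShape_of_closedUnderLimits _ _⟩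
    exact hasFiniteLimits_of_hasEqualizers_and_finite_products
end FreeCompletions
end

section
/- Let 𝒦 be a locally small category and let A_{ij} (i, j ∈ I) be objects of 𝒦 indexed by a set I. If the product over i ∈ I of the coproducts over j ∈ I of the representable presheaves Y(A_{ij}) exists in the free colimit completion 𝒫𝒦, then a pre-product of the family (A_{ii})_{i∈I} exists in 𝒦. -/
/- Common definitions for formalizing "How nice are free completions of categories?"
   by Adámek and Rosický. -/

open CategoryTheory CategoryTheory.Limits

universe w w₁ w₂ v₁ u₁

namespace FreeCompletions

universe v u

/-- Small presheaves are jointly covered by a small family of representables. -/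
theorem exists_cover_aux {K : Type u} [Category.{v} K] {F : Kᵒᵖ ⥤ Type v}
    (hF : IsSmallPresheaf.{v} F) :
    ∃ (J : Type v) (D : J → K) (e : ∀ j, yoneda.obj (D j) ⟶ F),
      ∀ (X : K) (x : yoneda.obj X ⟶ F), ∃ (j : J) (k : X ⟶ D j), yoneda.map k ≫ e j = x := by
  obtain ⟨J, _, D, c, ⟨hc⟩, ⟨φ⟩⟩ := hF
  refine ⟨J, D.obj, fun j => c.ι.app j ≫ φ.hom, fun X x => ?_⟩
  obtain ⟨j, k, hk⟩ := Types.jointly_surjective_of_isColimit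
    (isColimitOfPreserves ((evaluation _ _).obj (Opposite.op X)) hc) (yonedaEquiv (x ≫ φ.inv))
  refine ⟨j, k, ?_⟩
  have : yoneda.map k ≫ c.ι.app j = x ≫ φ.inv := by
    apply yonedaEquiv.injective
    rw [← hk, yonedaEquiv_comp, yonedaEquiv_yoneda_map]
    rfl
  rw [← Category.assoc]
  exact (Iso.comp_inv_eq φ).mp this.symm |>.symm

/-- Explicit model of the coproduct of representables. -/
def sigmaPre {K : Type u} [Category.{v} K] {I : Type v} (B : I → K) : Kᵒᵖ ⥤ Type v where
  obj U := Σ i, (U.unop ⟶ B i)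
  map g := ↾fun p => ⟨p.1, g.unop ≫ p.2⟩

/-- The injections into the explicit model. -/
def sigmaInc {K : Type u} [Category.{v} K] {I : Type v} (B : I → K) (i : I) :
    yoneda.obj (B i) ⟶ sigmaPre B where
  app U := ↾fun f => ⟨i, f⟩

theorem exists_fac_aux {K : Type u} [Category.{v} K] {I : Type v} (B : I → K) (i : I)
    {X D : K} (k : X ⟶ D) (f : X ⟶ B i) (α : yoneda.obj D ⟶ sigmaPre B)
    (hα : yoneda.map k ≫ α = yoneda.map f ≫ sigmaInc B i) : ∃ g : D ⟶ B i, k ≫ g = f := by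
  have h1 := congrArg yonedaEquiv hα
  rw [← yonedaEquiv_naturality, yonedaEquiv_comp, yonedaEquiv_yoneda_map] at h1
  generalize yonedaEquiv α = p at h1
  obtain ⟨j, g⟩ := p
  have h2 : (⟨j, k ≫ g⟩ : Σ i, (X ⟶ B i)) = ⟨i, f⟩ := h1
  obtain ⟨rfl, h3⟩ := Sigma.mk.inj_iff.mp h2
  exact ⟨g, eq_of_heq h3⟩

/-- Lemma 3.9, first part: given objects `A_{ij}` (`i, j ∈ I`) of `𝒦`
such that the product `∏_{i ∈ I} ∐_{j ∈ I} Y(A_{ij})` exists in `𝒫𝒦`, a pre-product of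
`(A_{ii})_{i ∈ I}` exists in `𝒦`. -/
theorem hasPreProduct_of_hasProduct_of_coproducts (K : Type u) [Category.{v} K]
    (I : Type v) (A : I → I → K)
    (h : HasProduct (fun i : I => pcoprodObj (A i))) :
    HasPreProduct.{v} (fun i : I => A i i) := by
  classical
  obtain ⟨J, D, e, he⟩ := exists_cover_aux (∏ᶜ fun i : I => pcoprodObj (A i)).property
  refine ⟨Σ j, ∀ i, D j ⟶ A i i, fun t => D t.1, fun t => t.2, fun X f => ?_⟩
  let B : PUnit.{v+1} → K := fun _ => X
  let ℓ : pcoprodObj B ⟶ ∏ᶜ fun i : I => pcoprodObj (A i) :=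
    Pi.lift fun i => ObjectProperty.homMk
      (Limits.Sigma.desc fun _ => yoneda.map (f i) ≫ Sigma.ι (fun j => yoneda.obj (A i j)) i)
  let L : (∐ fun b => yoneda.obj (B b)) ⟶ (∏ᶜ fun i : I => pcoprodObj (A i)).obj := ℓ.hom
  obtain ⟨j, k, hk⟩ := he X (Sigma.ι (fun b => yoneda.obj (B b)) PUnit.unit ≫ L)
  have key : ∀ i, ∃ g : D j ⟶ A i i, k ≫ g = f i := by
    intro i
    let q : (∐ fun j => yoneda.obj (A i j)) ⟶ sigmaPre (A i) := Limits.Sigma.desc (sigmaInc (A i))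
    let p : (∏ᶜ fun i : I => pcoprodObj (A i)).obj ⟶ ∐ fun j => yoneda.obj (A i j) :=
      (Pi.π (fun i : I => pcoprodObj (A i)) i).hom
    refine exists_fac_aux (A i) i k (f i) (e j ≫ p ≫ q) ?_
    have h0 : ℓ ≫ Pi.π (fun i : I => pcoprodObj (A i)) i = ObjectProperty.homMk
        (Limits.Sigma.desc fun _ => yoneda.map (f i) ≫
          Sigma.ι (fun j => yoneda.obj (A i j)) i) := limit.lift_π _ _
    have h1 : L ≫ p =
        Limits.Sigma.desc fun _ => yoneda.map (f i) ≫ Sigma.ι (fun j => yoneda.obj (A i j)) i :=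
      congrArg InducedCategory.Hom.hom h0
    rw [reassoc_of% hk, reassoc_of% h1, Sigma.ι_desc_assoc, Category.assoc, Sigma.ι_desc]
  choose g hg using key
  exact ⟨⟨j, g⟩, k, hg⟩
end FreeCompletions
end
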